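/- Boundedness of S_y^α when η > α+1 (first Proposition thmBound): let α > -1, β > 0, η > α+1, y ≥ 0, and fix I ∈ ℍ with I² = -1. Then there exists a constant C > 0 such that for every measurable φ : (0,∞) → ℍ with ∫_0^∞ ‖φ(x)‖² x^α e^{-x} dx < ∞, ∫∫_{{u²+v²<1}} ‖S_y^α φ(u+vI)‖² ω_{β,η}(u²+v²) du dv ≤ C · ∫_0^∞ ‖φ(x)‖² x^α e^{-x} dx. -/

import Mathlib

open MeasureTheory Real Quaternion

/-- Generalized Laguerre polynomial `L_n^{(α)}(x)`. -/
noncomputable def genLaguerre (α : ℝ) (n : ℕ) (x : ℝ) : ℝ :=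
  ∑ k ∈ Finset.range (n + 1),
    ((-1 : ℝ) ^ k / (Nat.factorial k)) *
      (Real.Gamma (n + α + 1) / (Real.Gamma (k + α + 1) * (Nat.factorial (n - k)))) * x ^ k

/-- Normalized Laguerre function `φ_n^α(x)`. -/
noncomputable def lagPhi (α : ℝ) (n : ℕ) (x : ℝ) : ℝ :=
  Real.sqrt ((Nat.factorial n : ℝ) / Real.Gamma (n + α + 1)) * genLaguerre α n x

/-- Weight `ω_{β,η}(t) = t^{β-1}(1-t)^{η-1}`. -/
noncomputable def weightBeta (β η t : ℝ) : ℝ := t ^ (β - 1) * (1 - t) ^ (η - 1)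

/-- The kernel `R_q^α(x,y) = Σ_n qⁿ φ_n^α(x) φ_n^α(y)`. -/
noncomputable def Rker (α : ℝ) (q : ℍ[ℝ]) (x y : ℝ) : ℍ[ℝ] :=
  ∑' n : ℕ, (lagPhi α n x * lagPhi α n y) • q ^ n

/-- The dual transform `S_y^α φ(q) = ∫_0^∞ R_q^α(x,y) φ(x) x^α e^{-x} dx`. -/
noncomputable def Sdual (α y : ℝ) (φ : ℝ → ℍ[ℝ]) (q : ℍ[ℝ]) : ℍ[ℝ] :=
  ∫ x in Set.Ioi (0 : ℝ), (x ^ α * Real.exp (-x)) • (Rker α q x y * φ x)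

open Polynomial in
noncomputable def lagCoef (α : ℝ) (n k : ℕ) : ℝ :=
  ((-1 : ℝ) ^ k / (Nat.factorial k)) *
      (Real.Gamma (n + α + 1) / (Real.Gamma (k + α + 1) * (Nat.factorial (n - k))))

noncomputable def lagPoly (α : ℝ) (n : ℕ) : Polynomial ℝ :=
  ∑ k ∈ Finset.range (n + 1), Polynomial.C (lagCoef α n k) * Polynomial.X ^ k

lemma lagPoly_eval (α : ℝ) (n : ℕ) (x : ℝ) : (lagPoly α n).eval x = genLaguerre α n x := by
  simp [lagPoly, genLaguerre, lagCoef, Polynomial.eval_finsetSum]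

lemma lagPoly_coeff (α : ℝ) (n k : ℕ) :
    (lagPoly α n).coeff k = if k < n + 1 then lagCoef α n k else 0 := by
  simp [lagPoly, Polynomial.coeff_X_pow, Finset.sum_ite_eq]

lemma gpos (α : ℝ) (hα : -1 < α) (n : ℕ) : 0 < Real.Gamma (n + α + 1) :=
  Real.Gamma_pos_of_pos (by have : (0:ℝ) ≤ n := Nat.cast_nonneg n
                            linarith)

lemma gsucc (α : ℝ) (hα : -1 < α) (n : ℕ) :
    Real.Gamma ((n + 1 : ℕ) + α + 1) = (n + α + 1) * Real.Gamma (n + α + 1) := by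
  have : (0:ℝ) ≤ n := Nat.cast_nonneg n
  rw [← Real.Gamma_add_one (by linarith)]
  push_cast; congr 1; ring

lemma lagCoef_rec (α : ℝ) (hα : -1 < α) (n k : ℕ) (h : k < n) :
    (k + 1) * (k + α + 1) * lagCoef α n (k + 1) + (n - k) * lagCoef α n k = 0 := by
  obtain ⟨m, rfl⟩ : ∃ m, n = k + 1 + m := ⟨n - (k + 1), by omega⟩
  unfold lagCoef
  rw [gsucc α hα k]
  have h1 : k + 1 + m - (k + 1) = m := by omega
  have h2 : k + 1 + m - k = m + 1 := by omega
  rw [h1, h2, Nat.factorial_succ, Nat.factorial_succ]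
  have : (0:ℝ) ≤ k := Nat.cast_nonneg k
  have a1 := (gpos α hα k).ne'
  have a2 : (k + α + 1 : ℝ) ≠ 0 := by linarith
  have a3 : (Nat.factorial k : ℝ) ≠ 0 := by positivity
  have a4 : (Nat.factorial m : ℝ) ≠ 0 := by positivity
  have a5 : (k + 1 : ℝ) ≠ 0 := by positivity
  have a6 : (m + 1 : ℝ) ≠ 0 := by positivity
  push_cast
  field_simp
  ring

open Polynomial in
lemma lagPoly_ode (α : ℝ) (hα : -1 < α) (n : ℕ) :
    X * derivative (derivative (lagPoly α n)) + (C (α + 1) - X) * derivative (lagPoly α n)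
      + C (n : ℝ) * lagPoly α n = 0 := by
  ext k
  have key : (k + 1) * (k + α + 1) * (lagPoly α n).coeff (k + 1)
      + (n - k) * (lagPoly α n).coeff k = 0 := by
    rw [lagPoly_coeff, lagPoly_coeff]
    rcases lt_trichotomy k n with h | h | h
    · rw [if_pos (by omega), if_pos (by omega)]; exact lagCoef_rec α hα n k h
    · subst h; simp
    · rw [if_neg (by omega), if_neg (by omega)]; simp
  rcases k with _ | k
  · simp [sub_mul, coeff_derivative] at key ⊢
    linarith
  · simp only [coeff_add, coeff_X_mul, coeff_derivative, sub_mul, coeff_sub, coeff_C_mul,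
      coeff_zero]
    push_cast at key ⊢
    linarith

open Polynomial in
lemma lagPoly_deriv (α : ℝ) (n : ℕ) :
    derivative (lagPoly α (n + 1)) = - lagPoly (α + 1) n := by
  ext k
  rw [coeff_derivative, coeff_neg, lagPoly_coeff, lagPoly_coeff]
  by_cases h : k < n + 1
  · rw [if_pos (by omega), if_pos h]
    unfold lagCoef
    rw [Nat.factorial_succ, Nat.add_sub_add_right]
    have e1 : ((n + 1 : ℕ) + α + 1 : ℝ) = n + (α + 1) + 1 := by push_cast; ring
    have e2 : ((k + 1 : ℕ) + α + 1 : ℝ) = k + (α + 1) + 1 := by push_cast; ring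
    rw [e1, e2]
    have a5 : (k + 1 : ℝ) ≠ 0 := by positivity
    have a3 : (Nat.factorial k : ℝ) ≠ 0 := by positivity
    push_cast
    field_simp
    ring
  · rw [if_neg (by omega), if_neg h]; simp

/-- `A_n = Γ(n+α+1)/n!` -/
noncomputable def lagA (α : ℝ) (n : ℕ) : ℝ := Real.Gamma (n + α + 1) / Nat.factorial n

lemma lagA_pos (α : ℝ) (hα : -1 < α) (n : ℕ) : 0 < lagA α n := by
  have := gpos α hα n
  unfold lagA; positivity

lemma lagPoly_zero (α : ℝ) (n : ℕ) :
    (lagPoly α n).eval 0 = lagA α n / Real.Gamma (α + 1) := by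
  rw [← Polynomial.coeff_zero_eq_eval_zero, lagPoly_coeff]
  simp [lagCoef, lagA]
  rw [div_div, mul_comm]

/-- derivative of the energy -/
lemma lag_energy_deriv (α : ℝ) (hα : -1 < α) (n : ℕ) (x : ℝ) :
    HasDerivAt (fun x => n * (lagPoly α n).eval x ^ 2
        + x * (lagPoly α n).derivative.eval x ^ 2)
      ((2 * x - 2 * α - 1) * (lagPoly α n).derivative.eval x ^ 2) x := by
  have h1 := (lagPoly α n).hasDerivAt x
  have h2 := (lagPoly α n).derivative.hasDerivAt x
  have ode := congrArg (Polynomial.eval x) (lagPoly_ode α hα n)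
  simp at ode
  have := ((h1.pow 2).const_mul (n : ℝ)).add ((hasDerivAt_id x).mul (h2.pow 2))
  refine (this.congr_deriv ?_)
  simp
  linear_combination 2 * (Polynomial.eval x (lagPoly α n).derivative) * ode

lemma lag_bound1 (α : ℝ) (hα : -1 / 2 ≤ α) (n : ℕ) (x : ℝ) (hx : 0 ≤ x) :
    (lagPoly α n).eval x ^ 2 ≤ Real.exp (2 * x) * (lagA α n / Real.Gamma (α + 1)) ^ 2 := by
  have hα' : -1 < α := by linarith
  rcases Nat.eq_zero_or_pos n with rfl | hn
  · have hG := (gpos α hα' 0)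
    simp at hG
    have e1 : (lagPoly α 0).eval x = 1 := by
      simp [lagPoly, lagCoef, hG.ne']
    have e2 : lagA α 0 / Real.Gamma (α + 1) = 1 := by
      simp [lagA, hG.ne']
    rw [e1, e2]; simpa using hx
  let E : ℝ → ℝ := fun x => n * (lagPoly α n).eval x ^ 2
        + x * (lagPoly α n).derivative.eval x ^ 2
  have hE : ∀ x, HasDerivAt (fun x => Real.exp (-(2 * x)) * E x)
      (Real.exp (-(2 * x)) * ((2 * x - 2 * α - 1) * (lagPoly α n).derivative.eval x ^ 2 - 2 * E x))
      x := by
    intro x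
    have h1 : HasDerivAt (fun x : ℝ => Real.exp (-(2 * x))) (Real.exp (-(2 * x)) * (-(2 * 1))) x :=
      (((hasDerivAt_id x).const_mul 2).neg).exp
    refine (h1.mul (lag_energy_deriv α hα' n x)).congr_deriv ?_
    simp only [E]; ring
  have anti : AntitoneOn (fun x => Real.exp (-(2 * x)) * E x) (Set.Ici 0) := by
    refine antitoneOn_of_hasDerivWithinAt_nonpos (convex_Ici 0)
      (fun x _ => (hE x).continuousAt.continuousWithinAt)
      (fun x _ => (hE x).hasDerivWithinAt) ?_
    intro x hx
    simp at hx
    apply mul_nonpos_of_nonneg_of_nonpos (Real.exp_nonneg _)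
    simp only [E]
    have : 0 ≤ (n:ℝ) * (lagPoly α n).eval x ^ 2 := by positivity
    nlinarith [sq_nonneg ((lagPoly α n).derivative.eval x)]
  have := anti (Set.mem_Ici.2 le_rfl) (Set.mem_Ici.2 hx) hx
  simp only [E, mul_zero, neg_zero, Real.exp_zero, one_mul, zero_mul, add_zero,
    lagPoly_zero] at this
  have hn' : (0:ℝ) < n := by exact_mod_cast hn
  have e : Real.exp (-(2 * x)) = (Real.exp (2 * x))⁻¹ := Real.exp_neg _
  rw [e, inv_mul_le_iff₀ (Real.exp_pos _)] at this
  have h0 : 0 ≤ x * (lagPoly α n).derivative.eval x ^ 2 := by positivity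
  refine le_of_mul_le_mul_left ?_ hn'
  nlinarith

lemma lag_bound2 (α : ℝ) (hα : -1 < α) (y : ℝ) (hy : 0 ≤ y) :
    ∃ C : ℝ, 0 < C ∧ ∀ n : ℕ, (lagPoly α n).eval y ^ 2 ≤ C * (n + 1) * lagA α n ^ 2 := by
  have hG : 0 < Real.Gamma (α + 1) := Real.Gamma_pos_of_pos (by linarith)
  have hG2 : 0 < Real.Gamma (α + 1 + 1) := Real.Gamma_pos_of_pos (by linarith)
  by_cases h : -1 / 2 ≤ α
  · refine ⟨Real.exp (2 * y) / Real.Gamma (α + 1) ^ 2, by positivity, fun n => ?_⟩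
    refine (lag_bound1 α h n y hy).trans ?_
    have : Real.exp (2 * y) / Real.Gamma (α + 1) ^ 2 * (n + 1) * lagA α n ^ 2
      = Real.exp (2 * y) * (lagA α n / Real.Gamma (α + 1)) ^ 2 * (n + 1) := by
      field_simp
    rw [this]
    apply le_mul_of_one_le_right (by positivity)
    simp
  · push Not at h
    set D := Real.exp (2 * y) / Real.Gamma (α + 1 + 1) ^ 2 * (2 * y + 1) * y with hD
    have hD0 : 0 ≤ D := by positivity
    refine ⟨1 / Real.Gamma (α + 1) ^ 2 + D, by positivity, fun n => ?_⟩
    rcases n with _ | n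
    · have e1 : (lagPoly α 0).eval y = 1 := by
        have : (Real.Gamma (α + 1)) ≠ 0 := hG.ne'
        simp [lagPoly, lagCoef, this]
      rw [e1]; simp [lagA]
      have : (Real.Gamma (α + 1) ^ 2)⁻¹ * Real.Gamma (α + 1) ^ 2 = 1 := by field_simp
      nlinarith [sq_nonneg (Real.Gamma (α + 1))]
    have hA : lagA (α + 1) n = (n + 1) * lagA α (n + 1) := by
      unfold lagA
      rw [Nat.factorial_succ]
      have e1 : ((n + 1 : ℕ) + α + 1 : ℝ) = n + (α + 1) + 1 := by push_cast; ring
      rw [e1]; push_cast; field_simp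
    let K : ℝ := Real.exp (2 * y) / Real.Gamma (α + 1 + 1) ^ 2 * (2 * y + 1) * lagA (α + 1) n ^ 2
    have mono : AntitoneOn (fun x => ((n + 1 : ℕ) * (lagPoly α (n + 1)).eval x ^ 2
        + x * (lagPoly α (n + 1)).derivative.eval x ^ 2) - K * x) (Set.Icc 0 y) := by
      have hd : ∀ x, HasDerivAt (fun x => ((n + 1 : ℕ) * (lagPoly α (n + 1)).eval x ^ 2
        + x * (lagPoly α (n + 1)).derivative.eval x ^ 2) - K * x)
          ((2 * x - 2 * α - 1) * (lagPoly α (n + 1)).derivative.eval x ^ 2 - K * 1) x := by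
        intro x
        exact (lag_energy_deriv α hα (n + 1) x).sub ((hasDerivAt_id x).const_mul K)
      refine antitoneOn_of_hasDerivWithinAt_nonpos (convex_Icc 0 y)
        (fun x _ => (hd x).continuousAt.continuousWithinAt)
        (fun x _ => (hd x).hasDerivWithinAt) ?_
      intro x hx
      simp at hx
      rw [lagPoly_deriv, Polynomial.eval_neg, neg_sq]
      have b := lag_bound1 (α + 1) (by linarith) n x hx.1.le
      have b2 : (lagPoly (α + 1) n).eval x ^ 2
          ≤ Real.exp (2 * y) * (lagA (α + 1) n / Real.Gamma (α + 1 + 1)) ^ 2 := by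
        refine b.trans ?_
        gcongr
        exact hx.2.le
      have : (2 * x - 2 * α - 1) * (lagPoly (α + 1) n).eval x ^ 2 ≤
          (2 * y + 1) * (Real.exp (2 * y) * (lagA (α + 1) n / Real.Gamma (α + 1 + 1)) ^ 2) := by
        apply mul_le_mul _ b2 (sq_nonneg _) (by positivity)
        linarith [hx.2]
      have hK : K = (2 * y + 1) * (Real.exp (2 * y) * (lagA (α + 1) n / Real.Gamma (α + 1 + 1)) ^ 2) := by
        simp only [K]; field_simp
      linarith
    have := mono (Set.left_mem_Icc.2 hy) (Set.right_mem_Icc.2 hy) hy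
    simp only [zero_mul, add_zero, lagPoly_zero, mul_zero, sub_zero] at this
    have hKD : K * y = D * (n + 1) ^ 2 * lagA α (n + 1) ^ 2 := by
      simp only [K, hD, hA]; ring
    have hn : (0:ℝ) < n + 1 := by positivity
    have h0 : 0 ≤ y * (lagPoly α (n + 1)).derivative.eval y ^ 2 := by positivity
    refine le_of_mul_le_mul_left ?_ hn
    push_cast at this ⊢
    have e : (lagA α (n + 1) / Real.Gamma (α + 1)) ^ 2
      = 1 / Real.Gamma (α + 1) ^ 2 * lagA α (n + 1) ^ 2 := by field_simp
    rw [e] at this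
    have h3 : 0 ≤ 1 / Real.Gamma (α + 1) ^ 2 * lagA α (n + 1) ^ 2 := by positivity
    have h4 : 0 ≤ D * lagA α (n + 1) ^ 2 := by positivity
    have hn0 : (0:ℝ) ≤ n := by positivity
    nlinarith [mul_nonneg hn0 h3, mul_nonneg hn0 h4, mul_nonneg hn0 (mul_nonneg hn0 h3)]

lemma lagPhi_sq (α : ℝ) (hα : -1 < α) (n : ℕ) (x : ℝ) :
    lagPhi α n x ^ 2 = (lagA α n)⁻¹ * (lagPoly α n).eval x ^ 2 := by
  unfold lagPhi
  have := gpos α hα n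
  rw [mul_pow, Real.sq_sqrt (by positivity), lagPoly_eval, lagA, inv_div]

lemma lagPhi_bound (α : ℝ) (hα : -1 < α) (y : ℝ) (hy : 0 ≤ y) :
    ∃ C : ℝ, 0 < C ∧ ∀ n : ℕ, lagPhi α n y ^ 2 ≤ C * ((n + 1) * lagA α n) := by
  obtain ⟨C, hC, h⟩ := lag_bound2 α hα y hy
  refine ⟨C, hC, fun n => ?_⟩
  have hA := lagA_pos α hα n
  rw [lagPhi_sq α hα, inv_mul_le_iff₀ hA]
  refine (h n).trans (le_of_eq ?_)
  ring

noncomputable def lagMu (α : ℝ) : Measure ℝ :=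
  (volume.restrict (Set.Ioi (0 : ℝ))).withDensity
    (fun x => ENNReal.ofReal (x ^ α * Real.exp (-x)))

lemma lagW_meas (α : ℝ) : Measurable (fun x : ℝ => ENNReal.ofReal (x ^ α * Real.exp (-x))) := by
  fun_prop

lemma lagMu_integral {E : Type*} [NormedAddCommGroup E] [NormedSpace ℝ E] (α : ℝ) (g : ℝ → E) :
    ∫ x, g x ∂(lagMu α) = ∫ x in Set.Ioi (0:ℝ), (x ^ α * Real.exp (-x)) • g x := by
  unfold lagMu
  rw [integral_withDensity_eq_integral_toReal_smul (lagW_meas α) (by simp)]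
  refine setIntegral_congr_fun measurableSet_Ioi fun x hx => ?_
  have hx' : (0:ℝ) < x := hx
  rw [ENNReal.toReal_ofReal (by positivity)]

lemma lagMu_integrable {E : Type*} [NormedAddCommGroup E] [NormedSpace ℝ E] (α : ℝ) (g : ℝ → E) :
    Integrable g (lagMu α) ↔
      IntegrableOn (fun x => (x ^ α * Real.exp (-x)) • g x) (Set.Ioi 0) := by
  unfold lagMu
  rw [integrable_withDensity_iff_integrable_smul' (lagW_meas α) (by simp)]
  refine integrableOn_congr_fun (fun x hx => ?_) measurableSet_Ioi
  have hx' : (0:ℝ) < x := hx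
  rw [ENNReal.toReal_ofReal (by positivity)]

lemma lagMu_pow (α : ℝ) (hα : -1 < α) (k : ℕ) :
    Integrable (fun x : ℝ => x ^ k) (lagMu α) ∧
      ∫ x, x ^ k ∂(lagMu α) = Real.Gamma (k + α + 1) := by
  have hk : (0:ℝ) ≤ k := Nat.cast_nonneg k
  have hp : 0 < (k + α + 1 : ℝ) := by linarith
  have e : ∀ x ∈ Set.Ioi (0:ℝ), Real.exp (-x) * x ^ ((k + α + 1 : ℝ) - 1)
      = (x ^ α * Real.exp (-x)) • x ^ k := by
    intro x hx
    have hx' : (0:ℝ) < x := hx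
    rw [show ((k + α + 1 : ℝ) - 1) = α + k by ring, Real.rpow_add hx', Real.rpow_natCast,
      smul_eq_mul]
    ring
  constructor
  · rw [lagMu_integrable]
    exact (integrableOn_congr_fun e measurableSet_Ioi).1 (Real.GammaIntegral_convergent hp)
  · rw [lagMu_integral, Real.Gamma_eq_integral hp]
    exact (setIntegral_congr_fun measurableSet_Ioi e).symm

lemma lagMu_poly_int (α : ℝ) (hα : -1 < α) (p : Polynomial ℝ) :
    Integrable (fun x : ℝ => p.eval x) (lagMu α) := by
  simp_rw [Polynomial.eval_eq_sum_range]
  exact integrable_finsetSum _ fun i _ => ((lagMu_pow α hα i).1.const_mul _)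

lemma gamma_asc (s : ℝ) (hs : 0 < s) (k : ℕ) :
    Real.Gamma (s + k) = Real.Gamma s * (ascPochhammer ℝ k).eval s := by
  induction k with
  | zero => simp
  | succ k ih =>
    rw [ascPochhammer_succ_eval, ← mul_assoc, ← ih, mul_comm,
      ← Real.Gamma_add_one (by positivity)]
    push_cast; congr 1; ring

lemma lag_moment (α : ℝ) (hα : -1 < α) (n k : ℕ) :
    ∫ x, (lagPoly α n).eval x * x ^ k ∂(lagMu α) =
      lagA α n * (-1) ^ n * ((fwdDiff (1:ℝ))^[n] (ascPochhammer ℝ k).eval) (α + 1) := by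
  have e : ∀ x : ℝ, (lagPoly α n).eval x * x ^ k
      = ∑ j ∈ Finset.range (n + 1), lagCoef α n j * x ^ (j + k) := by
    intro x
    simp only [lagPoly, Polynomial.eval_finsetSum, Finset.sum_mul, Polynomial.eval_mul,
      Polynomial.eval_C, Polynomial.eval_pow, Polynomial.eval_X]
    refine Finset.sum_congr rfl fun j _ => by ring
  simp_rw [e]
  rw [integral_finsetSum _ (fun j _ => ((lagMu_pow α hα (j + k)).1.const_mul _)),
    fwdDiff_iter_eq_sum_shift, Finset.mul_sum]
  refine Finset.sum_congr rfl fun j hj => ?_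
  have hj' : j ≤ n := by simpa [Nat.lt_succ_iff] using hj
  have hj0 : (0:ℝ) ≤ j := Nat.cast_nonneg j
  rw [integral_const_mul, (lagMu_pow α hα (j + k)).2]
  have e1 : ((j + k : ℕ) + α + 1 : ℝ) = (j + α + 1) + k := by push_cast; ring
  rw [e1, gamma_asc _ (by linarith)]
  have e2 : α + 1 + j • (1:ℝ) = j + α + 1 := by simp; ring
  rw [e2]
  have a1 := (gpos α hα j).ne'
  have hs : ((-1:ℝ)) ^ n * (-1) ^ (n - j) = (-1) ^ j := by
    rw [← pow_add, show n + (n - j) = 2 * (n - j) + j by omega, pow_add, pow_mul]; simp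
  simp only [lagCoef, lagA, zsmul_eq_mul]
  push_cast
  rw [Nat.cast_choose ℝ hj', ← hs]
  field_simp

lemma asc_natDegree (k : ℕ) : (ascPochhammer ℝ k).natDegree = k := by
  simp

lemma lag_moment_lt (α : ℝ) (hα : -1 < α) (n k : ℕ) (h : k < n) :
    ∫ x, (lagPoly α n).eval x * x ^ k ∂(lagMu α) = 0 := by
  rw [lag_moment α hα, Polynomial.fwdDiff_iter_eq_zero_of_degree_lt (by rwa [asc_natDegree])]
  simp

lemma lag_moment_eq (α : ℝ) (hα : -1 < α) (n : ℕ) :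
    ∫ x, (lagPoly α n).eval x * x ^ n ∂(lagMu α) = lagA α n * (-1) ^ n * Nat.factorial n := by
  rw [lag_moment α hα]
  have h := Polynomial.fwdDiff_iter_degree_eq_factorial (ascPochhammer ℝ n)
  rw [asc_natDegree, (monic_ascPochhammer ℝ n).leadingCoeff] at h
  rw [h]; simp

lemma lag_orth_le (α : ℝ) (hα : -1 < α) (n m : ℕ) (h : m ≤ n) :
    ∫ x, (lagPoly α n).eval x * (lagPoly α m).eval x ∂(lagMu α) = if n = m then lagA α n else 0 := by
  have e : ∀ x : ℝ, (lagPoly α n).eval x * (lagPoly α m).eval x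
      = ∑ j ∈ Finset.range (m + 1), lagCoef α m j * ((lagPoly α n).eval x * x ^ j) := by
    intro x
    conv_lhs => rw [lagPoly.eq_1 α m]
    simp only [Polynomial.eval_finsetSum, Finset.mul_sum, Polynomial.eval_mul,
      Polynomial.eval_C, Polynomial.eval_pow, Polynomial.eval_X]
    refine Finset.sum_congr rfl fun j _ => by ring
  have hint : ∀ j, Integrable (fun x : ℝ => (lagPoly α n).eval x * x ^ j) (lagMu α) := by
    intro j
    refine (lagMu_poly_int α hα (lagPoly α n * Polynomial.X ^ j)).congr
      (Filter.Eventually.of_forall fun x => ?_)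
    simp only [Polynomial.eval_mul, Polynomial.eval_pow, Polynomial.eval_X]
  simp_rw [e]
  rw [integral_finsetSum _ (fun j _ => (hint j).const_mul _)]
  simp_rw [integral_const_mul]
  split_ifs with hnm
  · subst hnm
    rw [Finset.sum_range_succ, Finset.sum_eq_zero, lag_moment_eq α hα]
    · have a1 := (gpos α hα n).ne'
      have : (Nat.factorial n : ℝ) ≠ 0 := by positivity
      simp only [lagCoef, Nat.sub_self, Nat.factorial_zero]
      have hs : ((-1:ℝ)) ^ n * (-1) ^ n = 1 := by rw [← mul_pow]; simp
      field_simp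
      simp only [Nat.cast_one]
      linear_combination (lagA α n) * hs
    · intro j hj
      rw [lag_moment_lt α hα n j (by simpa using hj), mul_zero]
  · apply Finset.sum_eq_zero
    intro j hj
    have : j ≤ m := by simpa [Nat.lt_succ_iff] using hj
    rw [lag_moment_lt α hα n j (by omega), mul_zero]

lemma lagPhi_eq (α : ℝ) (n : ℕ) (x : ℝ) :
    lagPhi α n x = Real.sqrt ((lagA α n)⁻¹) * (lagPoly α n).eval x := by
  rw [lagPhi, lagPoly_eval, lagA, inv_div]

lemma lagPhi_cont (α : ℝ) (n : ℕ) : Continuous (lagPhi α n) := by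
  have : lagPhi α n = fun x => Real.sqrt ((lagA α n)⁻¹) * (lagPoly α n).eval x :=
    funext (lagPhi_eq α n)
  rw [this]
  exact continuous_const.mul (lagPoly α n).continuous

lemma lagPhi_mul_int (α : ℝ) (hα : -1 < α) (n m : ℕ) :
    Integrable (fun x => lagPhi α n x * lagPhi α m x) (lagMu α) := by
  have := (lagMu_poly_int α hα (lagPoly α n * lagPoly α m)).const_mul
    (Real.sqrt ((lagA α n)⁻¹) * Real.sqrt ((lagA α m)⁻¹))
  refine this.congr (Filter.Eventually.of_forall fun x => ?_)
  simp only [lagPhi_eq, Polynomial.eval_mul]; ring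

lemma lagPhi_orth (α : ℝ) (hα : -1 < α) (n m : ℕ) :
    ∫ x, lagPhi α n x * lagPhi α m x ∂(lagMu α) = if n = m then 1 else 0 := by
  wlog h : m ≤ n generalizing n m
  · have := this m n (by omega)
    simp_rw [mul_comm (lagPhi α n _)]
    rw [this]; simp only [eq_comm]
  have e : ∀ x, lagPhi α n x * lagPhi α m x
      = (Real.sqrt ((lagA α n)⁻¹) * Real.sqrt ((lagA α m)⁻¹)) *
        ((lagPoly α n).eval x * (lagPoly α m).eval x) := by
    intro x; simp only [lagPhi_eq]; ring
  simp_rw [e]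
  rw [integral_const_mul, lag_orth_le α hα n m h]
  split_ifs with hnm
  · subst hnm
    have := lagA_pos α hα n
    rw [Real.mul_self_sqrt (by positivity)]
    field_simp
  · simp

lemma phi_meas (α : ℝ) (φ : ℝ → ℍ[ℝ]) (h : AEStronglyMeasurable φ (volume.restrict (Set.Ioi 0))) :
    AEStronglyMeasurable φ (lagMu α) :=
  h.mono_ac (withDensity_absolutelyContinuous _ _)

lemma phi_sq_int (α : ℝ) (φ : ℝ → ℍ[ℝ]) (h : AEStronglyMeasurable φ (volume.restrict (Set.Ioi 0)))
    (hf : (∫⁻ x in Set.Ioi (0 : ℝ),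
        ENNReal.ofReal (‖φ x‖ ^ 2 * (x ^ α * Real.exp (-x)))) < ⊤) :
    Integrable (fun x => ‖φ x‖ ^ 2) (lagMu α) ∧
    ENNReal.ofReal (∫ x, ‖φ x‖ ^ 2 ∂(lagMu α)) = ∫⁻ x in Set.Ioi (0 : ℝ),
        ENNReal.ofReal (‖φ x‖ ^ 2 * (x ^ α * Real.exp (-x))) := by
  have hnn : 0 ≤ᵐ[volume.restrict (Set.Ioi 0)]
      fun x : ℝ => ‖φ x‖ ^ 2 * (x ^ α * Real.exp (-x)) := by
    refine ae_restrict_of_forall_mem measurableSet_Ioi fun x hx => ?_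
    have hx' : (0:ℝ) < x := hx
    simp only [Pi.zero_apply]
    positivity
  have hint : IntegrableOn (fun x => ‖φ x‖ ^ 2 * (x ^ α * Real.exp (-x))) (Set.Ioi 0) := by
    refine ⟨(h.norm.pow 2).mul (Measurable.aestronglyMeasurable (by fun_prop)), ?_⟩
    rw [hasFiniteIntegral_iff_ofReal hnn]
    exact hf
  have e : ∀ x : ℝ, (x ^ α * Real.exp (-x)) • ‖φ x‖ ^ 2 = ‖φ x‖ ^ 2 * (x ^ α * Real.exp (-x)) :=
    fun x => by rw [smul_eq_mul, mul_comm]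
  constructor
  · rw [lagMu_integrable]
    simp_rw [e]
    exact hint
  · rw [lagMu_integral]
    simp_rw [e]
    rw [ofReal_integral_eq_lintegral_ofReal hint hnn]

noncomputable def lagC (α : ℝ) (φ : ℝ → ℍ[ℝ]) (n : ℕ) : ℍ[ℝ] := ∫ x, lagPhi α n x • φ x ∂(lagMu α)

lemma lagC_int (α : ℝ) (φ : ℝ → ℍ[ℝ]) (hα : -1 < α) (hm : AEStronglyMeasurable φ (lagMu α))
    (hi : Integrable (fun x => ‖φ x‖ ^ 2) (lagMu α)) (n : ℕ) : Integrable (fun x => lagPhi α n x • φ x) (lagMu α) ∧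
    ∫ x, ‖lagPhi α n x • φ x‖ ∂(lagMu α) ≤ 1 + ∫ x, ‖φ x‖ ^ 2 ∂(lagMu α) := by
  have h1 : Integrable (fun x => lagPhi α n x * lagPhi α n x + ‖φ x‖ ^ 2) (lagMu α) :=
    (lagPhi_mul_int α hα n n).add hi
  have hb : ∀ x, ‖lagPhi α n x • φ x‖ ≤ lagPhi α n x * lagPhi α n x + ‖φ x‖ ^ 2 := by
    intro x
    rw [norm_smul, Real.norm_eq_abs, ← abs_mul_abs_self (lagPhi α n x)]
    nlinarith [sq_nonneg (|lagPhi α n x| - ‖φ x‖), sq_nonneg (|lagPhi α n x|), sq_nonneg (‖φ x‖)]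
  have h2 : Integrable (fun x => lagPhi α n x • φ x) (lagMu α) :=
    h1.mono' ((lagPhi_cont α n).aestronglyMeasurable.smul hm) (Filter.Eventually.of_forall hb)
  refine ⟨h2, ?_⟩
  refine (integral_mono h2.norm h1 hb).trans (le_of_eq ?_)
  rw [integral_add (lagPhi_mul_int α hα n n) hi, lagPhi_orth α hα]
  simp

lemma bessel (α : ℝ) (φ : ℝ → ℍ[ℝ]) (hα : -1 < α) (hm : AEStronglyMeasurable φ (lagMu α))
    (hi : Integrable (fun x => ‖φ x‖ ^ 2) (lagMu α)) (N : ℕ) :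
    ∑ n ∈ Finset.range N, ‖lagC α φ n‖ ^ 2 ≤ ∫ x, ‖φ x‖ ^ 2 ∂(lagMu α) := by
  set c := lagC α φ with hc
  have hint := fun n => (lagC_int α φ hα hm hi n).1
  have h1 : ∀ n, Integrable (fun x => inner ℝ (c n) (lagPhi α n x • φ x)) (lagMu α) :=
    fun n => (hint n).const_inner (c n)
  have h2 : ∀ n m, Integrable (fun x => lagPhi α n x * lagPhi α m x * inner ℝ (c n) (c m))
      (lagMu α) := fun n m => (lagPhi_mul_int α hα n m).mul_const _
  have e : ∀ x, ‖φ x - ∑ n ∈ Finset.range N, lagPhi α n x • c n‖ ^ 2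
      = ‖φ x‖ ^ 2 - 2 * (∑ n ∈ Finset.range N, inner ℝ (c n) (lagPhi α n x • φ x))
        + ∑ n ∈ Finset.range N, ∑ m ∈ Finset.range N,
          lagPhi α n x * lagPhi α m x * inner ℝ (c n) (c m) := by
    intro x
    rw [norm_sub_sq_real, ← real_inner_self_eq_norm_sq (∑ n ∈ Finset.range N, lagPhi α n x • c n)]
    congr 1
    · congr 2
      rw [inner_sum]
      refine Finset.sum_congr rfl fun n _ => ?_
      rw [inner_smul_right, inner_smul_right, real_inner_comm]
    · rw [sum_inner]
      refine Finset.sum_congr rfl fun n _ => ?_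
      rw [inner_sum]
      refine Finset.sum_congr rfl fun m _ => ?_
      rw [real_inner_smul_left, real_inner_smul_right]; ring
  have hnn : 0 ≤ ∫ x, ‖φ x - ∑ n ∈ Finset.range N, lagPhi α n x • c n‖ ^ 2 ∂(lagMu α) :=
    integral_nonneg fun x => by positivity
  simp_rw [e] at hnn
  have I1 : Integrable (fun x => ∑ n ∈ Finset.range N, inner ℝ (c n) (lagPhi α n x • φ x))
      (lagMu α) := integrable_finsetSum _ fun n _ => h1 n
  have I2 : Integrable (fun x => ∑ n ∈ Finset.range N, ∑ m ∈ Finset.range N,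
          lagPhi α n x * lagPhi α m x * inner ℝ (c n) (c m)) (lagMu α) :=
    integrable_finsetSum _ fun n _ => integrable_finsetSum _ fun m _ => h2 n m
  have I3 : Integrable (fun x => ‖φ x‖ ^ 2 -
      2 * ∑ n ∈ Finset.range N, inner ℝ (c n) (lagPhi α n x • φ x)) (lagMu α) :=
    hi.sub (I1.const_mul 2)
  rw [integral_add I3 I2, integral_sub hi (I1.const_mul 2),
    integral_const_mul, integral_finsetSum _ (fun n _ => h1 n),
    integral_finsetSum _ (fun n _ => integrable_finsetSum _ fun m _ => h2 n m)] at hnn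
  have e1 : ∀ n, ∫ x, inner ℝ (c n) (lagPhi α n x • φ x) ∂(lagMu α) = ‖c n‖ ^ 2 := by
    intro n
    rw [integral_inner (hint n), ← real_inner_self_eq_norm_sq]
    rfl
  have e2 : ∀ n ∈ Finset.range N, ∫ x, ∑ m ∈ Finset.range N,
      lagPhi α n x * lagPhi α m x * inner ℝ (c n) (c m) ∂(lagMu α) = ‖c n‖ ^ 2 := by
    intro n hn
    rw [integral_finsetSum _ (fun m _ => h2 n m)]
    simp_rw [integral_mul_const, lagPhi_orth α hα]
    rw [Finset.sum_eq_single n]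
    · simp
    · intro m _ hm
      simp [hm.symm]
    · exact fun h => absurd hn h
  rw [Finset.sum_congr rfl e2] at hnn
  simp_rw [e1] at hnn
  linarith

lemma lag_summable (α : ℝ) (hα : -1 < α) (y : ℝ) (hy : 0 ≤ y) (r : ℝ) (hr : 0 ≤ r) (hr1 : r < 1) :
    Summable (fun n => r ^ n * |lagPhi α n y|) := by
  obtain ⟨C, hC, hb⟩ := lagPhi_bound α hα y hy
  have hs : Summable (fun n : ℕ => r ^ n * ((n + 1) * lagA α n)) := by
    apply summable_of_ratio_norm_eventually_le (r := (1 + r) / 2) (by linarith)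
    have ht : Filter.Tendsto (fun n : ℕ => r * ((1 + 1 / ((n:ℝ) + 1)) * (1 + α * (1 / ((n:ℝ) + 1)))))
        Filter.atTop (nhds (r * ((1 + 0) * (1 + α * 0)))) := by
      have := tendsto_one_div_add_atTop_nhds_zero_nat (𝕜 := ℝ)
      exact ((this.const_add 1).mul ((this.const_mul α).const_add 1)).const_mul r
    have hlt : r * ((1 + 0) * (1 + α * 0)) < (1 + r) / 2 := by simp; linarith
    filter_upwards [ht.eventually_lt_const hlt] with n hn
    have hA := lagA_pos α hα n
    have hA' : lagA α (n + 1) = (n + α + 1) / (n + 1) * lagA α n := by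
      unfold lagA
      rw [gsucc α hα, Nat.factorial_succ]; push_cast; field_simp
    have hAp := lagA_pos α hα (n + 1)
    have hn0 : (0:ℝ) ≤ n := Nat.cast_nonneg n
    rw [Real.norm_of_nonneg (by positivity), Real.norm_of_nonneg (by positivity), hA']
    have : r ^ (n + 1) * (((n + 1 : ℕ) + 1) * ((n + α + 1) / (n + 1) * lagA α n))
      = (r * ((1 + 1 / ((n:ℝ) + 1)) * (1 + α * (1 / ((n:ℝ) + 1))))) *
        (r ^ n * ((n + 1) * lagA α n)) := by
      push_cast; field_simp; ring
    rw [this]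
    gcongr
  have hs2 : Summable (fun n : ℕ => r ^ n + C * (r ^ n * ((n + 1) * lagA α n))) :=
    (summable_geometric_of_lt_one hr hr1).add (hs.mul_left C)
  refine hs2.of_nonneg_of_le (fun n => by positivity) fun n => ?_
  have h1 : |lagPhi α n y| ≤ 1 + C * ((n + 1) * lagA α n) := by
    have := hb n
    rw [← sq_abs] at this
    nlinarith [sq_nonneg (|lagPhi α n y| - 1), abs_nonneg (lagPhi α n y)]
  calc r ^ n * |lagPhi α n y| ≤ r ^ n * (1 + C * ((n + 1) * lagA α n)) := by gcongr
    _ = _ := by ring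

lemma sdual_hasSum (α : ℝ) (φ : ℝ → ℍ[ℝ]) (hα : -1 < α) (hm : AEStronglyMeasurable φ (lagMu α))
    (hi : Integrable (fun x => ‖φ x‖ ^ 2) (lagMu α)) (y : ℝ) (hy : 0 ≤ y) (q : ℍ[ℝ]) (hq : ‖q‖ < 1) :
    HasSum (fun n => q ^ n * (lagPhi α n y • lagC α φ n)) (Sdual α y φ q) := by
  have hS : Sdual α y φ q = ∫ x, ∑' n : ℕ, (lagPhi α n y • q ^ n) * (lagPhi α n x • φ x)
      ∂(lagMu α) := by
    rw [lagMu_integral]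
    unfold Sdual
    congr 1
    ext1 x
    congr 1
    unfold Rker
    rw [← tsum_mul_right]
    refine tsum_congr fun n => ?_
    rw [smul_mul_assoc, smul_mul_assoc, mul_smul_comm, smul_smul, mul_comm (lagPhi α n x)]
  have hint := fun n => (lagC_int α φ hα hm hi n)
  have key := hasSum_integral_of_summable_integral_norm (μ := lagMu α)
    (F := fun n x => (lagPhi α n y • q ^ n) * (lagPhi α n x • φ x))
    (fun n => (hint n).1.const_mul _) (by
      have hs := (lag_summable α hα y hy ‖q‖ (norm_nonneg q) hq).mul_right
        (1 + ∫ x, ‖φ x‖ ^ 2 ∂(lagMu α))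
      refine hs.of_nonneg_of_le (fun n => integral_nonneg fun x => norm_nonneg _) fun n => ?_
      have e : ∀ x, ‖(lagPhi α n y • q ^ n) * (lagPhi α n x • φ x)‖
          = (‖q‖ ^ n * |lagPhi α n y|) * ‖lagPhi α n x • φ x‖ := by
        intro x
        rw [norm_mul, norm_smul (lagPhi α n y), norm_pow, Real.norm_eq_abs]; ring
      simp_rw [e]
      rw [integral_const_mul]
      exact mul_le_mul_of_nonneg_left (hint n).2 (by positivity))
  rw [hS]
  refine key.congr_fun fun n => ?_
  have := ((ContinuousLinearMap.mul ℝ ℍ[ℝ]) (lagPhi α n y • q ^ n)).integral_comp_comm (hint n).1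
  simp only [ContinuousLinearMap.mul_apply'] at this
  rw [this, smul_mul_assoc, mul_smul_comm]
  rfl

lemma I_star (I : ℍ[ℝ]) (hI : I ^ 2 = -1) : star I = -I := by
  have h1 : Quaternion.normSq I ^ 2 = 1 := by
    rw [← map_pow, hI]; simp
  have h2 : Quaternion.normSq I = 1 := by
    have h0 : 0 ≤ Quaternion.normSq I := Quaternion.normSq_nonneg
    nlinarith
  have h3 : star I * I = 1 := by rw [Quaternion.star_mul_self, h2]; simp
  have h4 : I * (-I) = 1 := by rw [mul_neg, ← sq, hI]; simp
  calc star I = star I * (I * (-I)) := by rw [h4, mul_one]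
    _ = -I := by rw [← mul_assoc, h3, one_mul]

lemma inner_I_left (I : ℍ[ℝ]) (hI : I ^ 2 = -1) (a b : ℍ[ℝ]) :
    inner ℝ (I * a) b = - inner ℝ a (I * b) := by
  rw [Quaternion.inner_def, Quaternion.inner_def, star_mul, I_star I hI]
  simp [Quaternion.re_mul]
  ring

lemma inner_I_I (I : ℍ[ℝ]) (hI : I ^ 2 = -1) (a b : ℍ[ℝ]) :
    inner ℝ (I * a) (I * b) = inner ℝ a b := by
  rw [inner_I_left I hI, ← mul_assoc, ← sq, hI]; simp

lemma demoivre (I : ℍ[ℝ]) (hI : I ^ 2 = -1) (θ : ℝ) (n : ℕ) :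
    ((Real.cos θ : ℍ[ℝ]) + Real.sin θ • I) ^ n
      = (Real.cos (n * θ) : ℍ[ℝ]) + Real.sin (n * θ) • I := by
  induction n with
  | zero => simp
  | succ n ih =>
    rw [pow_succ, ih]
    push_cast
    rw [add_mul (n:ℝ) 1 θ, one_mul, Real.cos_add, Real.sin_add]
    have c : ∀ x : ℝ, (x : ℍ[ℝ]) = x • (1 : ℍ[ℝ]) := fun x => by
      rw [← Quaternion.coe_mul_eq_smul, mul_one]
    simp only [c, add_mul, mul_add, smul_mul_smul_comm, mul_one, one_mul, ← sq, hI, one_pow]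
    module

lemma int_cos (k : ℤ) : ∫ θ in (-π)..π, Real.cos (k * θ) = if k = 0 then 2 * π else 0 := by
  split_ifs with h
  · subst h; simp; ring
  · have hk : (k : ℝ) ≠ 0 := by exact_mod_cast h
    rw [intervalIntegral.integral_comp_mul_left (fun x => Real.cos x) hk]
    simp [Real.sin_int_mul_pi]

lemma int_sin (c : ℝ) : ∫ θ in (-π)..π, Real.sin (c * θ) = 0 := by
  by_cases h : c = 0
  · subst h; simp
  · rw [intervalIntegral.integral_comp_mul_left (fun x => Real.sin x) h]
    simp

lemma parseval (I : ℍ[ℝ]) (hI : I ^ 2 = -1) (b : ℕ → ℍ[ℝ]) (N : ℕ) :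
    ∫ θ in (-π)..π, ‖∑ n ∈ Finset.range N,
      (Real.cos (n * θ) • b n + Real.sin (n * θ) • (I * b n))‖ ^ 2
      = 2 * π * ∑ n ∈ Finset.range N, ‖b n‖ ^ 2 := by
  have e : ∀ θ : ℝ, ‖∑ n ∈ Finset.range N,
      (Real.cos (n * θ) • b n + Real.sin (n * θ) • (I * b n))‖ ^ 2
      = ∑ n ∈ Finset.range N, ∑ m ∈ Finset.range N,
        (Real.cos (((n : ℤ) - m : ℤ) * θ) * inner ℝ (b n) (b m)
          + Real.sin (((m : ℝ) - n) * θ) * inner ℝ (b n) (I * b m)) := by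
    intro θ
    rw [← real_inner_self_eq_norm_sq, sum_inner]
    refine Finset.sum_congr rfl fun n _ => ?_
    rw [inner_sum]
    refine Finset.sum_congr rfl fun m _ => ?_
    push_cast
    rw [sub_mul, sub_mul, Real.cos_sub, Real.sin_sub]
    simp only [inner_add_left, inner_add_right, real_inner_smul_left, real_inner_smul_right,
      inner_I_I I hI, inner_I_left I hI]
    ring
  simp_rw [e]
  rw [intervalIntegral.integral_finsetSum
    (fun n _ => (Continuous.intervalIntegrable (by fun_prop) _ _)), Finset.mul_sum]
  refine Finset.sum_congr rfl fun n hn => ?_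
  rw [intervalIntegral.integral_finsetSum
    (fun n _ => (Continuous.intervalIntegrable (by fun_prop) _ _))]
  have : ∀ m ∈ Finset.range N, (∫ θ in (-π)..π,
      (Real.cos (((n : ℤ) - m : ℤ) * θ) * inner ℝ (b n) (b m)
          + Real.sin (((m : ℝ) - n) * θ) * inner ℝ (b n) (I * b m)))
      = if m = n then 2 * π * ‖b n‖ ^ 2 else 0 := by
    intro m _
    rw [intervalIntegral.integral_add (Continuous.intervalIntegrable (by fun_prop) _ _)
      (Continuous.intervalIntegrable (by fun_prop) _ _), intervalIntegral.integral_mul_const,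
      intervalIntegral.integral_mul_const, int_cos, int_sin]
    by_cases h : m = n
    · subst h; simp
    · have : ¬ ((n:ℤ) - m = 0) := by omega
      rw [if_neg this, if_neg h]; simp
  rw [Finset.sum_congr rfl this, Finset.sum_ite_eq' , if_pos hn]

lemma slice_norm (I : ℍ[ℝ]) (hI : I ^ 2 = -1) (u v : ℝ) :
    ‖(u : ℍ[ℝ]) + v • I‖ ^ 2 = u ^ 2 + v ^ 2 := by
  have h1 : (u : ℍ[ℝ]) = u • (1 : ℍ[ℝ]) := by
    rw [← Quaternion.coe_mul_eq_smul, mul_one]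
  have h2 : inner ℝ (I * 1) (I * 1) = (inner ℝ (1 : ℍ[ℝ]) 1 : ℝ) := inner_I_I I hI 1 1
  have h3 : inner ℝ (I * 1) (1 : ℍ[ℝ]) = (0 : ℝ) := by
    have := inner_I_left I hI 1 1
    rw [real_inner_comm] at this ⊢
    linarith
  have h4 : inner ℝ (1 : ℍ[ℝ]) 1 = (1 : ℝ) := by simp
  rw [mul_one] at h2 h3
  rw [h1, ← real_inner_self_eq_norm_sq]
  simp only [inner_add_left, inner_add_right, real_inner_smul_left, real_inner_smul_right]
  have h5 : inner ℝ (1 : ℍ[ℝ]) I = (0 : ℝ) := by rw [real_inner_comm]; exact h3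
  rw [h2, h3, h5, h4]; ring

lemma theta_int (I : ℍ[ℝ]) (hI : I ^ 2 = -1) (a : ℕ → ℍ[ℝ]) (N : ℕ) (r : ℝ) :
    ∫⁻ θ in Set.Ioo (-π) π, ENNReal.ofReal (‖∑ n ∈ Finset.range N,
      (((r * Real.cos θ : ℝ) : ℍ[ℝ]) + (r * Real.sin θ) • I) ^ n * a n‖ ^ 2)
      = ENNReal.ofReal (2 * π * ∑ n ∈ Finset.range N, r ^ (2 * n) * ‖a n‖ ^ 2) := by
  have e : ∀ (θ : ℝ), ∑ n ∈ Finset.range N,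
      (((r * Real.cos θ : ℝ) : ℍ[ℝ]) + (r * Real.sin θ) • I) ^ n * a n
      = ∑ n ∈ Finset.range N,
      (Real.cos (n * θ) • (r ^ n • a n) + Real.sin (n * θ) • (I * (r ^ n • a n))) := by
    intro θ
    refine Finset.sum_congr rfl fun n _ => ?_
    have h1 : (((r * Real.cos θ : ℝ) : ℍ[ℝ]) + (r * Real.sin θ) • I)
      = r • ((Real.cos θ : ℍ[ℝ]) + Real.sin θ • I) := by
      rw [smul_add, smul_smul, Quaternion.smul_coe]
    rw [h1, smul_pow, demoivre I hI, smul_mul_assoc, add_mul, Quaternion.coe_mul_eq_smul,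
      smul_mul_assoc, mul_smul_comm]
    module
  have hp := parseval I hI (fun n => r ^ n • a n) N
  simp_rw [e]
  have hc : Continuous (fun θ : ℝ => ‖∑ n ∈ Finset.range N,
      (Real.cos (n * θ) • (r ^ n • a n) + Real.sin (n * θ) • (I * (r ^ n • a n)))‖ ^ 2) := by
    fun_prop
  have hle : -π ≤ π := by linarith [Real.pi_pos]
  rw [intervalIntegral.integral_of_le hle, integral_Ioc_eq_integral_Ioo] at hp
  rw [← ofReal_integral_eq_lintegral_ofReal _ (Filter.Eventually.of_forall fun _ => by positivity),
    hp]
  · congr 2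
    refine Finset.sum_congr rfl fun n _ => ?_
    rw [norm_smul, mul_pow, Real.norm_eq_abs, sq_abs, ← pow_mul, mul_comm n]
  · exact (hc.integrableOn_Icc (a := -π) (b := π)).mono_set Set.Ioo_subset_Icc_self

lemma radial_int (β η : ℝ) (hβ : 0 < β) (hη : 0 < η) (n : ℕ) :
    ∫⁻ r in Set.Ioo (0:ℝ) 1, ENNReal.ofReal (2 * r * (r ^ (2 * n) * weightBeta β η (r ^ 2)))
      = ENNReal.ofReal (ProbabilityTheory.beta (n + β) η) := by
  have hb : 0 < (n + β : ℝ) := by positivity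
  have hB := ProbabilityTheory.beta_pos hb hη
  have h1 := ProbabilityTheory.lintegral_betaPDF_eq_one hb hη
  rw [ProbabilityTheory.lintegral_betaPDF] at h1
  have h2 : ∫⁻ t in Set.Ioo (0:ℝ) 1, ENNReal.ofReal (t ^ ((n + β : ℝ) - 1) * (1 - t) ^ (η - 1))
      = ENNReal.ofReal (ProbabilityTheory.beta (n + β) η) := by
    have e : ∀ t : ℝ, ENNReal.ofReal (1 / ProbabilityTheory.beta (n + β) η *
        t ^ ((n + β : ℝ) - 1) * (1 - t) ^ (η - 1))
        = ENNReal.ofReal (1 / ProbabilityTheory.beta (n + β) η) *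
          ENNReal.ofReal (t ^ ((n + β : ℝ) - 1) * (1 - t) ^ (η - 1)) := by
      intro t
      rw [← ENNReal.ofReal_mul (by positivity), mul_assoc]
    simp_rw [e] at h1
    rw [lintegral_const_mul' _ _ ENNReal.ofReal_ne_top] at h1
    calc _ = ENNReal.ofReal (ProbabilityTheory.beta (n + β) η) *
        (ENNReal.ofReal (1 / ProbabilityTheory.beta (n + β) η) * ∫⁻ t in Set.Ioo (0:ℝ) 1,
          ENNReal.ofReal (t ^ ((n + β : ℝ) - 1) * (1 - t) ^ (η - 1))) := by
          rw [← mul_assoc, ← ENNReal.ofReal_mul hB.le, mul_one_div_cancel hB.ne']; simp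
      _ = _ := by rw [h1, mul_one]
  rw [← h2]
  have himg : (fun r : ℝ => r ^ 2) '' Set.Ioo 0 1 = Set.Ioo 0 1 := by
    ext t
    constructor
    · rintro ⟨r, ⟨h0, h1⟩, rfl⟩
      exact ⟨by positivity, by nlinarith⟩
    · rintro ⟨h0, h1⟩
      refine ⟨Real.sqrt t, ⟨Real.sqrt_pos.2 h0, ?_⟩, Real.sq_sqrt h0.le⟩
      rw [Real.sqrt_lt' one_pos]; simpa using h1
  have hinj : Set.InjOn (fun r : ℝ => r ^ 2) (Set.Ioo 0 1) := by
    intro x hx y hy h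
    exact (pow_left_inj₀ hx.1.le hy.1.le two_ne_zero).1 h
  have hcv := lintegral_image_eq_lintegral_abs_deriv_mul (measurableSet_Ioo (a := (0:ℝ)) (b := 1))
    (f := fun r => r ^ 2) (f' := fun r => 2 * r)
    (fun x _ => by simpa using (hasDerivAt_pow 2 x).hasDerivWithinAt) hinj
    (fun t => ENNReal.ofReal (t ^ ((n + β : ℝ) - 1) * (1 - t) ^ (η - 1)))
  rw [himg] at hcv
  rw [hcv]
  refine setLIntegral_congr_fun measurableSet_Ioo fun r hr => ?_
  have hr0 : 0 < r := hr.1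
  rw [abs_of_pos (by positivity), ← ENNReal.ofReal_mul (by positivity)]
  congr 2
  rw [weightBeta, pow_mul, show ((n + β : ℝ) - 1) = n + (β - 1) by ring,
    Real.rpow_add (by positivity), Real.rpow_natCast]
  ring

lemma disk_int (β η : ℝ) (hβ : 0 < β) (hη : 0 < η) (I : ℍ[ℝ]) (hI : I ^ 2 = -1)
    (a : ℕ → ℍ[ℝ]) (N : ℕ) :
    ∫⁻ p in {p : ℝ × ℝ | p.1 ^ 2 + p.2 ^ 2 < 1},
        ENNReal.ofReal (‖∑ n ∈ Finset.range N, ((p.1 : ℍ[ℝ]) + p.2 • I) ^ n * a n‖ ^ 2 *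
          weightBeta β η (p.1 ^ 2 + p.2 ^ 2))
      ≤ ENNReal.ofReal (π * ∑ n ∈ Finset.range N,
          ProbabilityTheory.beta (n + β) η * ‖a n‖ ^ 2) := by
  have hS : MeasurableSet {p : ℝ × ℝ | p.1 ^ 2 + p.2 ^ 2 < 1} :=
    measurableSet_lt (by fun_prop) (by fun_prop)
  rw [← lintegral_indicator hS, ← lintegral_comp_polarCoord_symm]
  let F : ℝ × ℝ → ENNReal := fun p => (Set.Ioo (0:ℝ) 1).indicator
    (fun r => ENNReal.ofReal (r * weightBeta β η (r ^ 2))) p.1 *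
      ENNReal.ofReal (‖∑ n ∈ Finset.range N,
      (((p.1 * Real.cos p.2 : ℝ) : ℍ[ℝ]) + (p.1 * Real.sin p.2) • I) ^ n * a n‖ ^ 2)
  have hF : ∀ p ∈ polarCoord.target, ENNReal.ofReal p.1 •
      ({p : ℝ × ℝ | p.1 ^ 2 + p.2 ^ 2 < 1}.indicator (fun p : ℝ × ℝ =>
        ENNReal.ofReal (‖∑ n ∈ Finset.range N, ((p.1 : ℍ[ℝ]) + p.2 • I) ^ n * a n‖ ^ 2 *
          weightBeta β η (p.1 ^ 2 + p.2 ^ 2)))) (polarCoord.symm p) = F p := by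
    rintro ⟨r, θ⟩ ⟨hr, -⟩
    have hr0 : 0 < r := hr
    have hsq : (r * Real.cos θ) ^ 2 + (r * Real.sin θ) ^ 2 = r ^ 2 := by
      linear_combination r ^ 2 * Real.sin_sq_add_cos_sq θ
    simp only [polarCoord_symm_apply, F, Set.indicator_apply, Set.mem_ofPred_eq, hsq, Set.mem_Ioo,
      smul_eq_mul]
    by_cases h1 : r < 1
    · have h2 : r ^ 2 < 1 := by nlinarith
      have hw : 0 ≤ weightBeta β η (r ^ 2) := by
        have : 0 ≤ 1 - r ^ 2 := by linarith
        unfold weightBeta; positivity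
      rw [if_pos h2, if_pos ⟨hr0, h1⟩, ← ENNReal.ofReal_mul hr0.le,
        ← ENNReal.ofReal_mul (by positivity)]
      congr 1; ring
    · have h2 : ¬ r ^ 2 < 1 := by nlinarith
      rw [if_neg h2, if_neg (fun h => h1 h.2)]; simp
  rw [setLIntegral_congr_fun polarCoord.open_target.measurableSet hF]
  have ht : (volume : Measure (ℝ × ℝ)).restrict polarCoord.target
      = (volume.restrict (Set.Ioi 0)).prod (volume.restrict (Set.Ioo (-π) π)) := by
    rw [Measure.prod_restrict]; rfl
  rw [ht]
  refine (lintegral_prod_le _).trans ?_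
  have hinner : ∀ r : ℝ, ∫⁻ θ in Set.Ioo (-π) π, F (r, θ) = (Set.Ioo (0:ℝ) 1).indicator
    (fun r => ∑ n ∈ Finset.range N, ENNReal.ofReal (π * ‖a n‖ ^ 2) *
        ENNReal.ofReal (2 * r * (r ^ (2 * n) * weightBeta β η (r ^ 2)))) r := by
    intro r
    simp only [F]
    rw [lintegral_const_mul'']
    · rw [theta_int I hI]
      by_cases hr : r ∈ Set.Ioo (0:ℝ) 1
      · rw [Set.indicator_of_mem hr, Set.indicator_of_mem hr]
        have hr0 : 0 < r := hr.1
        have hw : 0 ≤ weightBeta β η (r ^ 2) := by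
          have : 0 ≤ 1 - r ^ 2 := by nlinarith [hr.1, hr.2]
          unfold weightBeta; positivity
        have hpi := Real.pi_pos
        simp_rw [← ENNReal.ofReal_mul (show 0 ≤ π * ‖a _‖ ^ 2 by positivity)]
        rw [← ENNReal.ofReal_mul (by positivity),
          ← ENNReal.ofReal_sum_of_nonneg (fun n _ => by positivity)]
        congr 1
        rw [Finset.mul_sum, Finset.mul_sum]
        refine Finset.sum_congr rfl fun n _ => by ring
      · rw [Set.indicator_of_notMem hr, Set.indicator_of_notMem hr, zero_mul]
    · refine (Continuous.measurable ?_).ennreal_ofReal.aemeasurable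
      have : Continuous (fun θ : ℝ => ((r * Real.cos θ : ℝ) : ℍ[ℝ])) :=
        Quaternion.continuous_coe.comp (by fun_prop)
      fun_prop
  simp_rw [hinner]
  refine (setLIntegral_le_lintegral _ _).trans ?_
  rw [lintegral_indicator measurableSet_Ioo, lintegral_finsetSum' _ (fun n _ => by
    refine (Measurable.const_mul (Measurable.ennreal_ofReal ?_) _).aemeasurable
    unfold weightBeta
    fun_prop)]
  simp_rw [lintegral_const_mul' _ _ ENNReal.ofReal_ne_top, radial_int β η hβ hη]
  have hpi := Real.pi_pos
  have hB : ∀ n : ℕ, 0 < ProbabilityTheory.beta (n + β) η :=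
    fun n => ProbabilityTheory.beta_pos (by positivity) hη
  simp_rw [← ENNReal.ofReal_mul (show 0 ≤ π * ‖a _‖ ^ 2 by positivity)]
  rw [← ENNReal.ofReal_sum_of_nonneg (fun n _ => by have := hB n; positivity), Finset.mul_sum]
  refine le_of_eq ?_
  congr 1
  refine Finset.sum_congr rfl fun n _ => by ring

lemma u_bound (α β η : ℝ) (hα : -1 < α) (hβ : 0 < β) (hη : α + 1 < η) :
    ∃ C : ℝ, 0 < C ∧ ∀ n : ℕ,
      (n + 1) * lagA α n * ProbabilityTheory.beta (n + β) η ≤ C := by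
  have hη0 : 0 < η := by linarith
  have hB : ∀ n : ℕ, 0 < ProbabilityTheory.beta (n + β) η :=
    fun n => ProbabilityTheory.beta_pos (by positivity) hη0
  let u : ℕ → ℝ := fun n => (n + 1) * lagA α n * ProbabilityTheory.beta (n + β) η
  have hu : ∀ n, 0 < u n := fun n => by
    have := lagA_pos α hα n
    have := hB n
    simp only [u]; positivity
  set K := 1 + 2 * β + 2 * η - 2 * α - 2 - 3 * β - α * β with hK
  set L := β + η - 2 * (α + 1) * β with hL
  obtain ⟨N, hN⟩ := exists_nat_ge ((|K| + |L|) / (η - α - 1) + 1)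
  have hd : 0 < η - α - 1 := by linarith
  have hstep : ∀ n, N ≤ n → u (n + 1) ≤ u n := by
    intro n hn
    have hn' : (N : ℝ) ≤ n := by exact_mod_cast hn
    have hq : (|K| + |L|) / (η - α - 1) ≥ 0 := by positivity
    have hn1 : (1:ℝ) ≤ n := by linarith
    have hn2 : (|K| + |L|) ≤ n * (η - α - 1) := by
      rw [← div_le_iff₀ hd]; linarith
    have hA' : lagA α (n + 1) = (n + α + 1) / (n + 1) * lagA α n := by
      unfold lagA
      rw [gsucc α hα, Nat.factorial_succ]; push_cast; field_simp
    have hB' : ProbabilityTheory.beta ((n + 1 : ℕ) + β) η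
        = (n + β) / (n + β + η) * ProbabilityTheory.beta (n + β) η := by
      unfold ProbabilityTheory.beta
      have e1 : ((n + 1 : ℕ) + β : ℝ) = (n + β) + 1 := by push_cast; ring
      have e2 : ((n + β) + 1 + η : ℝ) = (n + β + η) + 1 := by ring
      rw [e1, e2, Real.Gamma_add_one (by positivity), Real.Gamma_add_one (by positivity)]
      have := (Real.Gamma_pos_of_pos (show 0 < (n + β + η : ℝ) by positivity)).ne'
      field_simp
    have hA := lagA_pos α hα n
    have hb := hB n
    have e : u (n + 1) = ((n + 2) * (n + α + 1) * (n + β)) / ((n + 1) ^ 2 * (n + β + η)) * u n := by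
      simp only [u, hA', hB']
      push_cast
      field_simp
      ring
    rw [e]
    refine mul_le_of_le_one_left (hu n).le ?_
    rw [div_le_one (by positivity)]
    have k1 : -(|K| * n) ≤ K * n := by nlinarith [neg_abs_le K]
    have k2 : -(|L| * n) ≤ L := by nlinarith [neg_abs_le L, abs_nonneg L]
    have k3 : (|K| + |L|) * n ≤ n * (η - α - 1) * n := by nlinarith
    have : (n + 1) ^ 2 * (n + β + η) - (n + 2) * (n + α + 1) * (n + β)
      = n * (η - α - 1) * n + K * n + L := by rw [hK, hL]; ring
    linarith
  refine ⟨∑ i ∈ Finset.range (N + 1), u i,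
    Finset.sum_pos (fun i _ => hu i) ⟨0, by simp⟩, fun n => ?_⟩
  have hle : ∀ m ≤ N, u m ≤ ∑ i ∈ Finset.range (N + 1), u i := fun m hm =>
    Finset.single_le_sum (fun i _ => (hu i).le) (by simp; omega)
  rcases le_total n N with h | h
  · exact hle n h
  · have : u n ≤ u N := by
      induction n, h using Nat.le_induction with
      | base => exact le_rfl
      | succ n hn ih => exact (hstep n hn).trans ih
    exact this.trans (hle N le_rfl)

/-- Boundedness of `S_y^α : L^{2,α}(ℝ₊;ℍ) → L^{2,ω_{β,η}}(𝔹_I)` when `η > α + 1`. -/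
theorem stmt_6 (α β η : ℝ) (hα : -1 < α) (hβ : 0 < β) (hη : α + 1 < η)
    (y : ℝ) (hy : 0 ≤ y) (I : ℍ[ℝ]) (hI : I ^ 2 = -1) :
    ∃ C : ℝ, 0 < C ∧ ∀ φ : ℝ → ℍ[ℝ],
      AEStronglyMeasurable φ (volume.restrict (Set.Ioi 0)) →
      (∫⁻ x in Set.Ioi (0 : ℝ),
        ENNReal.ofReal (‖φ x‖ ^ 2 * (x ^ α * Real.exp (-x)))) < ⊤ →
      (∫⁻ p in {p : ℝ × ℝ | p.1 ^ 2 + p.2 ^ 2 < 1},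
        ENNReal.ofReal (‖Sdual α y φ ((p.1 : ℍ[ℝ]) + p.2 • I)‖ ^ 2 *
          weightBeta β η (p.1 ^ 2 + p.2 ^ 2))) ≤
      ENNReal.ofReal C *
        ∫⁻ x in Set.Ioi (0 : ℝ),
          ENNReal.ofReal (‖φ x‖ ^ 2 * (x ^ α * Real.exp (-x))) := by
  obtain ⟨C1, hC1, h1⟩ := lagPhi_bound α hα y hy
  obtain ⟨C2, hC2, h2⟩ := u_bound α β η hα hβ hη
  have hη0 : 0 < η := by linarith
  have hpi := Real.pi_pos
  refine ⟨π * (C1 * C2), by positivity, fun φ hφ hf => ?_⟩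
  have hm := phi_meas α φ hφ
  obtain ⟨hi, heq⟩ := phi_sq_int α φ hφ hf
  rw [← heq, ← ENNReal.ofReal_mul (by positivity)]
  have hB : ∀ n : ℕ, 0 < ProbabilityTheory.beta (n + β) η :=
    fun n => ProbabilityTheory.beta_pos (by positivity) hη0
  set a : ℕ → ℍ[ℝ] := fun n => lagPhi α n y • lagC α φ n with ha
  let G : ℕ → ℝ × ℝ → ENNReal := fun N p =>
    ENNReal.ofReal (‖∑ n ∈ Finset.range N, ((p.1 : ℍ[ℝ]) + p.2 • I) ^ n * a n‖ ^ 2 *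
          weightBeta β η (p.1 ^ 2 + p.2 ^ 2))
  have hG : ∀ N, ∫⁻ p in {p : ℝ × ℝ | p.1 ^ 2 + p.2 ^ 2 < 1}, G N p ≤
      ENNReal.ofReal (π * (C1 * C2) * ∫ x, ‖φ x‖ ^ 2 ∂(lagMu α)) := by
    intro N
    refine (disk_int β η hβ hη0 I hI a N).trans (ENNReal.ofReal_le_ofReal ?_)
    rw [mul_assoc π]
    refine mul_le_mul_of_nonneg_left ?_ hpi.le
    refine le_trans ?_ (mul_le_mul_of_nonneg_left (bessel α φ hα hm hi N) (by positivity))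
    rw [Finset.mul_sum]
    refine Finset.sum_le_sum fun n _ => ?_
    have e : ‖a n‖ ^ 2 = lagPhi α n y ^ 2 * ‖lagC α φ n‖ ^ 2 := by
      rw [ha]; simp only [norm_smul, mul_pow, Real.norm_eq_abs, sq_abs]
    rw [e, ← mul_assoc]
    refine mul_le_mul_of_nonneg_right ?_ (by positivity)
    calc ProbabilityTheory.beta (n + β) η * lagPhi α n y ^ 2
        ≤ ProbabilityTheory.beta (n + β) η * (C1 * ((n + 1) * lagA α n)) :=
          mul_le_mul_of_nonneg_left (h1 n) (hB n).le
      _ = C1 * ((n + 1) * lagA α n * ProbabilityTheory.beta (n + β) η) := by ring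
      _ ≤ C1 * C2 := mul_le_mul_of_nonneg_left (h2 n) hC1.le
  have hS : MeasurableSet {p : ℝ × ℝ | p.1 ^ 2 + p.2 ^ 2 < 1} :=
    measurableSet_lt (by fun_prop) (by fun_prop)
  have hlim : ∀ p ∈ {p : ℝ × ℝ | p.1 ^ 2 + p.2 ^ 2 < 1},
      ENNReal.ofReal (‖Sdual α y φ ((p.1 : ℍ[ℝ]) + p.2 • I)‖ ^ 2 *
          weightBeta β η (p.1 ^ 2 + p.2 ^ 2)) = Filter.liminf (fun N => G N p) Filter.atTop := by
    intro p hp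
    have hp' : p.1 ^ 2 + p.2 ^ 2 < 1 := hp
    have hq : ‖(p.1 : ℍ[ℝ]) + p.2 • I‖ < 1 := by
      have := slice_norm I hI p.1 p.2
      nlinarith [norm_nonneg ((p.1 : ℍ[ℝ]) + p.2 • I)]
    have ht := (sdual_hasSum α φ hα hm hi y hy _ hq).tendsto_sum_nat
    refine (Filter.Tendsto.liminf_eq ?_).symm
    exact ENNReal.tendsto_ofReal ((ht.norm.pow 2).mul_const _)
  rw [setLIntegral_congr_fun hS hlim]
  refine (lintegral_liminf_le fun N => ?_).trans ?_
  · refine Measurable.ennreal_ofReal (Measurable.mul ?_ ?_)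
    · refine Continuous.measurable ?_
      have : Continuous (fun p : ℝ × ℝ => (p.1 : ℍ[ℝ])) :=
        Quaternion.continuous_coe.comp continuous_fst
      fun_prop
    · unfold weightBeta
      fun_prop
  · exact Filter.liminf_le_of_frequently_le' (Filter.Frequently.of_forall hG)
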